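/- Let p, q : [0,1) → ℝ be continuous with ∫₀¹|p(x)|dx < ∞ and ∫₀¹|q(x)|dx < ∞, let ξ ∈ [0,1) and η ∈ ℝ, and let y be the (unique) solution of the Cauchy problem y' + p(x)y = q(x), y(ξ) = η, namely y(x) = e^{−∫_ξ^x p(t)dt}(η + ∫_ξ^x q(t) e^{∫_ξ^t p(s)ds} dt). If for each sufficiently large n, ȳ_n denotes the solution of the discretized integral equation of order n, then ȳ_n converges to y uniformly on [0,1): sup_{x∈[0,1)} |y(x) − ȳ_n(x)| → 0 as n → ∞. -/

import Mathlib

open MeasureTheory Matrix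

/-- The `k`-th binary digit of `x ∈ [0,1)`, using the expansion terminating in zeros
for dyadic rationals. -/
noncomputable def binDigit (k : ℕ) (x : ℝ) : ℕ := ⌊x * 2 ^ (k + 1)⌋.toNat % 2

/-- Rademacher functions `r_k(x) = (-1)^{x_k}`. -/
noncomputable def rademacher (k : ℕ) (x : ℝ) : ℝ := (-1 : ℝ) ^ binDigit k x

/-- Walsh–Paley functions `ω_n(x) = ∏_k r_k(x)^{n_k}`. -/
noncomputable def walsh (n : ℕ) (x : ℝ) : ℝ :=
  ∏ k ∈ Finset.range n, if n.testBit k then rademacher k x else 1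

/-- Walsh–Fourier coefficient `f̂_k = ∫₀¹ f ω_k`. -/
noncomputable def fcoef (f : ℝ → ℝ) (k : ℕ) : ℝ := ∫ x in (0:ℝ)..1, f x * walsh k x

/-- The `2^n`-th partial sum of the Walsh–Fourier series:
`S_{2^n} f (x) = ∑_{k<2^n} f̂_k ω_k(x)`. -/
noncomputable def S2 (n : ℕ) (f : ℝ → ℝ) (x : ℝ) : ℝ :=
  ∑ k ∈ Finset.range (2 ^ n), fcoef f k * walsh k x

lemma measurable_rademacher (k : ℕ) : Measurable (rademacher k) := by
  have h : Measurable fun x : ℝ => ⌊x * 2 ^ (k + 1)⌋ :=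
    Int.measurable_floor.comp (measurable_id.mul_const _)
  exact (measurable_from_top (f := fun z : ℤ => (-1 : ℝ) ^ (z.toNat % 2))).comp h

lemma rademacher_eq_or (k : ℕ) (x : ℝ) : rademacher k x = 1 ∨ rademacher k x = -1 :=
  neg_one_pow_eq_or ℝ _

lemma measurable_walsh (n : ℕ) : Measurable (walsh n) := by
  unfold walsh
  refine Finset.measurable_fun_prod _ fun k _ => ?_
  split_ifs
  · exact measurable_rademacher k
  · exact measurable_const

lemma abs_walsh (n : ℕ) (x : ℝ) : |walsh n x| = 1 := by
  rw [walsh, Finset.abs_prod]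
  refine Finset.prod_eq_one fun k _ => ?_
  split_ifs
  · rcases rademacher_eq_or k x with h | h <;> simp [h]
  · simp

/-- Any number of binary digits that exhausts `m` may be used to compute `walsh m`. -/
lemma walsh_eq_prod_range {m N : ℕ} (h : m < 2 ^ N) (x : ℝ) :
    walsh m x = ∏ k ∈ Finset.range N, if m.testBit k then rademacher k x else 1 := by
  have key : ∀ A B : ℕ, m < 2 ^ A → A ≤ B →
      (∏ k ∈ Finset.range A, if m.testBit k then rademacher k x else 1) =
        ∏ k ∈ Finset.range B, if m.testBit k then rademacher k x else 1 := by
    intro A B hA hAB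
    refine Finset.prod_subset (Finset.range_mono hAB) fun k _ hk => ?_
    have hk' : A ≤ k := by simpa using hk
    rw [Nat.testBit_lt_two_pow (hA.trans_le (Nat.pow_le_pow_right (by norm_num) hk'))]
    simp
  rw [walsh, key m (max m N) Nat.lt_two_pow_self (le_max_left _ _),
    key N (max m N) h (le_max_right _ _)]

lemma walsh_two_pow_add {n j : ℕ} (hj : j < 2 ^ n) (x : ℝ) :
    walsh (2 ^ n + j) x = rademacher n x * walsh j x := by
  rw [walsh_eq_prod_range (N := n + 1) (by rw [pow_succ]; omega), Finset.prod_range_succ,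
    walsh_eq_prod_range hj, mul_comm]
  congr 1
  · rw [Nat.testBit_two_pow_add_eq, Nat.testBit_lt_two_pow hj]
    simp
  · refine Finset.prod_congr rfl fun k hk => ?_
    rw [Nat.testBit_two_pow_add_gt (by simpa using hk)]

/-- The Walsh–Dirichlet kernel of order `2 ^ n`. -/
noncomputable def walshKernel (n : ℕ) (t x : ℝ) : ℝ :=
  ∑ k ∈ Finset.range (2 ^ n), walsh k t * walsh k x

lemma walshKernel_succ (n : ℕ) (t x : ℝ) :
    walshKernel (n + 1) t x = walshKernel n t x * (1 + rademacher n t * rademacher n x) := by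
  simp only [walshKernel]
  rw [pow_succ, mul_two, Finset.sum_range_add, mul_add, mul_one, Finset.sum_mul]
  congr 1
  refine Finset.sum_congr rfl fun j hj => ?_
  rw [walsh_two_pow_add (by simpa using hj), walsh_two_pow_add (by simpa using hj)]
  ring

lemma floor_mul_two_pow_succ (n : ℕ) {x : ℝ} (hx : 0 ≤ x) :
    ⌊x * 2 ^ (n + 1)⌋ = 2 * ⌊x * 2 ^ n⌋ + binDigit n x := by
  have h1 : ⌊x * 2 ^ n⌋ = ⌊x * 2 ^ (n + 1)⌋ / 2 := by
    have h := Int.floor_div_natCast (x * 2 ^ (n + 1)) 2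
    push_cast at h
    rw [← h, pow_succ, ← mul_assoc, mul_div_cancel_right₀ _ two_ne_zero]
  have h2 : 0 ≤ ⌊x * 2 ^ (n + 1)⌋ := Int.floor_nonneg.2 (by positivity)
  unfold binDigit
  omega

lemma binDigit_lt_two (n : ℕ) (x : ℝ) : binDigit n x < 2 := Nat.mod_lt _ (by norm_num)

lemma walshKernel_eq (n : ℕ) {t x : ℝ} (ht : t ∈ Set.Ico (0 : ℝ) 1)
    (hx : x ∈ Set.Ico (0 : ℝ) 1) :
    walshKernel n t x = if ⌊t * 2 ^ n⌋ = ⌊x * 2 ^ n⌋ then 2 ^ n else 0 := by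
  induction n with
  | zero =>
    have h : ∀ z ∈ Set.Ico (0 : ℝ) 1, ⌊z⌋ = 0 := fun z hz => Int.floor_eq_zero_iff.2 hz
    simp [walshKernel, walsh, h t ht, h x hx]
  | succ n ih =>
    rw [walshKernel_succ, ih, floor_mul_two_pow_succ n ht.1, floor_mul_two_pow_succ n hx.1]
    have h1 := binDigit_lt_two n t
    have h2 := binDigit_lt_two n x
    unfold rademacher
    by_cases h : ⌊t * 2 ^ n⌋ = ⌊x * 2 ^ n⌋
    · rw [h]
      interval_cases binDigit n t <;> interval_cases binDigit n x <;> norm_num [pow_succ]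
    · rw [if_neg h, if_neg (by omega), zero_mul]

lemma walshKernel_nonneg (n : ℕ) {t x : ℝ} (ht : t ∈ Set.Ico (0 : ℝ) 1)
    (hx : x ∈ Set.Ico (0 : ℝ) 1) : 0 ≤ walshKernel n t x := by
  rw [walshKernel_eq n ht hx]
  split_ifs <;> positivity

lemma abs_sub_le_of_walshKernel_ne_zero {n : ℕ} {t x : ℝ} (ht : t ∈ Set.Ico (0 : ℝ) 1)
    (hx : x ∈ Set.Ico (0 : ℝ) 1) (h : walshKernel n t x ≠ 0) : |t - x| ≤ (1 / 2) ^ n := by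
  rw [walshKernel_eq n ht hx] at h
  have h' : ⌊t * 2 ^ n⌋ = ⌊x * 2 ^ n⌋ := by
    by_contra hne
    simp [hne] at h
  have h2 := (Int.abs_sub_lt_one_of_floor_eq_floor h').le
  rw [← sub_mul, abs_mul, abs_of_pos (by positivity : (0 : ℝ) < 2 ^ n)] at h2
  rw [one_div, inv_pow, ← one_div, le_div_iff₀ (by positivity)]
  exact h2

lemma measurable_walshKernel (n : ℕ) (x : ℝ) : Measurable fun t => walshKernel n t x :=
  Finset.measurable_fun_sum _ fun k _ => (measurable_walsh k).mul_const _

lemma abs_walshKernel_le (n : ℕ) (t x : ℝ) : |walshKernel n t x| ≤ 2 ^ n := by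
  refine (Finset.abs_sum_le_sum_abs _ _).trans (le_of_eq ?_)
  simp [abs_mul, abs_walsh]

lemma setIntegral_walshKernel (n : ℕ) {x : ℝ} (hx : x ∈ Set.Ico (0 : ℝ) 1) :
    ∫ t in Set.Ico (0 : ℝ) 1, walshKernel n t x = 1 := by
  set j : ℤ := ⌊x * 2 ^ n⌋ with hj
  have hpos : (0 : ℝ) < 2 ^ n := by positivity
  have hj0 : (0 : ℝ) ≤ j := Int.cast_nonneg (Int.floor_nonneg.2 (mul_nonneg hx.1 hpos.le))
  have hj1 : (j : ℝ) + 1 ≤ 2 ^ n := by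
    have : j < 2 ^ n := by
      rw [hj, Int.floor_lt]
      push_cast
      nlinarith [hx.2]
    exact_mod_cast this
  have hsub : Set.Ico ((j : ℝ) / 2 ^ n) ((j + 1) / 2 ^ n) ⊆ Set.Ico (0 : ℝ) 1 := by
    intro t ht
    refine ⟨(div_nonneg hj0 hpos.le).trans ht.1, ht.2.trans_le ?_⟩
    rwa [div_le_one hpos]
  calc ∫ t in Set.Ico (0 : ℝ) 1, walshKernel n t x
      = ∫ t in Set.Ico (0 : ℝ) 1,
          (Set.Ico ((j : ℝ) / 2 ^ n) ((j + 1) / 2 ^ n)).indicator (fun _ => (2 : ℝ) ^ n) t := by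
        refine setIntegral_congr_fun measurableSet_Ico fun t ht => ?_
        simp only [walshKernel_eq n ht hx, Set.indicator_apply, Set.mem_Ico, ← hj,
          div_le_iff₀ hpos, lt_div_iff₀ hpos, Int.floor_eq_iff]
    _ = 1 := by
        rw [setIntegral_indicator measurableSet_Ico, Set.inter_eq_right.2 hsub,
          setIntegral_const, Real.volume_real_Ico_of_le (by gcongr; linarith)]
        simp only [smul_eq_mul]
        field_simp
        ring

lemma fcoef_eq_setIntegral (f : ℝ → ℝ) (k : ℕ) :
    fcoef f k = ∫ x in Set.Ico (0 : ℝ) 1, f x * walsh k x := by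
  rw [fcoef, intervalIntegral.integral_of_le zero_le_one, integral_Ico_eq_integral_Ioc]

lemma integrableOn_mul_walsh {f : ℝ → ℝ} (hf : IntegrableOn f (Set.Ico 0 1)) (k : ℕ) :
    IntegrableOn (fun x => f x * walsh k x) (Set.Ico 0 1) :=
  hf.mul_bdd (c := 1) (measurable_walsh k).aestronglyMeasurable
    (Filter.Eventually.of_forall fun x => by simp [abs_walsh])

lemma integrableOn_mul_walshKernel {f : ℝ → ℝ} (hf : IntegrableOn f (Set.Ico 0 1)) (n : ℕ)
    (x : ℝ) : IntegrableOn (fun t => f t * walshKernel n t x) (Set.Ico 0 1) :=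
  hf.mul_bdd (c := 2 ^ n) (measurable_walshKernel n x).aestronglyMeasurable
    (Filter.Eventually.of_forall fun t => abs_walshKernel_le n t x)

lemma S2_eq_setIntegral {f : ℝ → ℝ} (hf : IntegrableOn f (Set.Ico 0 1)) (n : ℕ) (x : ℝ) :
    S2 n f x = ∫ t in Set.Ico (0 : ℝ) 1, f t * walshKernel n t x := by
  simp only [S2, walshKernel, Finset.mul_sum, fcoef_eq_setIntegral, ← mul_assoc]
  rw [integral_finsetSum _ fun k _ => (integrableOn_mul_walsh hf k).mul_const _]
  simp only [integral_mul_const]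

lemma measurable_S2 (n : ℕ) (f : ℝ → ℝ) : Measurable (S2 n f) :=
  Finset.measurable_fun_sum _ fun k _ => (measurable_walsh k).const_mul _

lemma exists_abs_S2_le (n : ℕ) (f : ℝ → ℝ) : ∃ C, ∀ x, |S2 n f x| ≤ C := by
  refine ⟨∑ k ∈ Finset.range (2 ^ n), |fcoef f k|, fun x => ?_⟩
  refine (Finset.abs_sum_le_sum_abs _ _).trans (le_of_eq ?_)
  simp [abs_mul, abs_walsh]

lemma integrableOn_Ico_of_bounded {f : ℝ → ℝ} (hf : Measurable f) {C : ℝ}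
    (hC : ∀ x, |f x| ≤ C) : IntegrableOn f (Set.Ico 0 1) :=
  Measure.integrableOn_of_bounded (by simp) hf.aestronglyMeasurable
    (Filter.Eventually.of_forall hC)

lemma integrableOn_S2 (n : ℕ) (f : ℝ → ℝ) : IntegrableOn (S2 n f) (Set.Ico 0 1) :=
  integrableOn_Ico_of_bounded (measurable_S2 n f) (exists_abs_S2_le n f).choose_spec

lemma S2_sub {f g : ℝ → ℝ} (hf : IntegrableOn f (Set.Ico 0 1))
    (hg : IntegrableOn g (Set.Ico 0 1)) (n : ℕ) (x : ℝ) :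
    S2 n (fun t => f t - g t) x = S2 n f x - S2 n g x := by
  rw [S2_eq_setIntegral hf, S2_eq_setIntegral hg,
    S2_eq_setIntegral (f := fun t => f t - g t) (hf.sub hg), ← integral_sub
    (integrableOn_mul_walshKernel hf n x) (integrableOn_mul_walshKernel hg n x)]
  simp only [sub_mul]

lemma S2_const (c : ℝ) (n : ℕ) {x : ℝ} (hx : x ∈ Set.Ico (0 : ℝ) 1) :
    S2 n (fun _ => c) x = c := by
  rw [S2_eq_setIntegral (integrableOn_const (by simp)), integral_const_mul,
    setIntegral_walshKernel n hx, mul_one]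

lemma S2_congr {f g : ℝ → ℝ} (h : Set.EqOn f g (Set.Ico 0 1)) (n : ℕ) (x : ℝ) :
    S2 n f x = S2 n g x := by
  refine Finset.sum_congr rfl fun k _ => ?_
  rw [fcoef_eq_setIntegral, fcoef_eq_setIntegral]
  congr 1
  exact setIntegral_congr_fun measurableSet_Ico fun t ht => by simp only [h ht]

/-- `S2 n f x` is an average of the values of `f` at distance at most `2⁻ⁿ` from `x`. -/
lemma abs_S2_le_of_forall {f : ℝ → ℝ} (hf : IntegrableOn f (Set.Ico 0 1)) {n : ℕ} {x C : ℝ}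
    (hx : x ∈ Set.Ico (0 : ℝ) 1)
    (h : ∀ t ∈ Set.Ico (0 : ℝ) 1, |t - x| ≤ (1 / 2) ^ n → |f t| ≤ C) : |S2 n f x| ≤ C := by
  have hC : C = ∫ t in Set.Ico (0 : ℝ) 1, C * walshKernel n t x := by
    rw [integral_const_mul, setIntegral_walshKernel n hx, mul_one]
  rw [S2_eq_setIntegral hf, hC, ← Real.norm_eq_abs]
  have hi : IntegrableOn (fun _ : ℝ => C) (Set.Ico 0 1) := integrableOn_const (by simp)
  refine norm_integral_le_of_norm_le (integrableOn_mul_walshKernel hi n x) ?_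
  filter_upwards [ae_restrict_mem measurableSet_Ico] with t ht
  rw [norm_mul, Real.norm_eq_abs, Real.norm_eq_abs, abs_of_nonneg (walshKernel_nonneg n ht hx)]
  by_cases h0 : walshKernel n t x = 0
  · simp [h0]
  · exact mul_le_mul_of_nonneg_right (h t ht (abs_sub_le_of_walshKernel_ne_zero ht hx h0))
      (walshKernel_nonneg n ht hx)

lemma setIntegral_S2 {f : ℝ → ℝ} (hf : IntegrableOn f (Set.Ico 0 1)) (n : ℕ) :
    ∫ x in Set.Ico (0 : ℝ) 1, S2 n f x = ∫ x in Set.Ico (0 : ℝ) 1, f x := by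
  have h1 : IntegrableOn (fun _ : ℝ => (1 : ℝ)) (Set.Ico 0 1) := integrableOn_const (by simp)
  calc ∫ x in Set.Ico (0 : ℝ) 1, S2 n f x
      = ∑ k ∈ Finset.range (2 ^ n), fcoef f k * fcoef (fun _ => 1) k := by
        simp only [S2]
        rw [integral_finsetSum]
        · refine Finset.sum_congr rfl fun k _ => ?_
          rw [integral_const_mul, fcoef_eq_setIntegral (fun _ => 1)]
          simp
        · intro k _
          have := (integrableOn_mul_walsh h1 k).const_mul (fcoef f k)
          simpa using this
    _ = ∫ x in Set.Ico (0 : ℝ) 1, f x * S2 n (fun _ => 1) x := by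
        simp only [S2, Finset.mul_sum]
        rw [integral_finsetSum]
        · refine Finset.sum_congr rfl fun k _ => ?_
          rw [fcoef_eq_setIntegral f, mul_comm, ← integral_const_mul]
          congr 1
          ext x
          ring
        · intro k _
          have := (integrableOn_mul_walsh hf k).const_mul (fcoef (fun _ => 1) k)
          refine this.congr (Filter.Eventually.of_forall fun x => ?_)
          simp only
          ring
    _ = ∫ x in Set.Ico (0 : ℝ) 1, f x :=
        setIntegral_congr_fun measurableSet_Ico fun x hx => by
          simp only [S2_const 1 n hx, mul_one]

lemma setIntegral_abs_S2_le {f : ℝ → ℝ} (hf : IntegrableOn f (Set.Ico 0 1)) (n : ℕ) :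
    ∫ x in Set.Ico (0 : ℝ) 1, |S2 n f x| ≤ ∫ x in Set.Ico (0 : ℝ) 1, |f x| := by
  rw [← setIntegral_S2 (f := fun x => |f x|) hf.abs n]
  refine setIntegral_mono_on (integrableOn_S2 n f).abs (integrableOn_S2 n _)
    measurableSet_Ico fun x hx => ?_
  rw [S2_eq_setIntegral hf, S2_eq_setIntegral (f := fun x => |f x|) hf.abs]
  refine abs_integral_le_integral_abs.trans (le_of_eq ?_)
  refine setIntegral_congr_fun measurableSet_Ico fun t ht => ?_
  simp only [abs_mul, abs_of_nonneg (walshKernel_nonneg n ht hx)]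

lemma eventually_half_pow_le {δ : ℝ} (hδ : 0 < δ) :
    ∀ᶠ n : ℕ in Filter.atTop, (1 / 2 : ℝ) ^ n < δ :=
  (tendsto_pow_atTop_nhds_zero_of_lt_one (by norm_num) (by norm_num)).eventually_lt_const hδ

lemma eventually_forall_abs_sub_le {g : ℝ → ℝ} (hg : ContinuousOn g (Set.Icc 0 1)) {ε : ℝ}
    (hε : 0 < ε) : ∀ᶠ n : ℕ in Filter.atTop, ∀ x ∈ Set.Ico (0 : ℝ) 1, ∀ t ∈ Set.Ico (0 : ℝ) 1,
      |t - x| ≤ (1 / 2) ^ n → |g t - g x| ≤ ε := by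
  obtain ⟨δ, hδ, h⟩ := Metric.uniformContinuousOn_iff.1
    (isCompact_Icc.uniformContinuousOn_of_continuous hg) ε hε
  filter_upwards [eventually_half_pow_le hδ] with n hn x hx t ht htx
  exact (h t (Set.Ico_subset_Icc_self ht) x (Set.Ico_subset_Icc_self hx)
    (htx.trans_lt hn)).le

lemma integrableOn_Ico_of_continuousOn {g : ℝ → ℝ} (hg : ContinuousOn g (Set.Icc 0 1)) :
    IntegrableOn g (Set.Ico 0 1) :=
  hg.integrableOn_Icc.mono_set Set.Ico_subset_Icc_self

lemma eventually_abs_S2_sub_le {g : ℝ → ℝ} (hg : ContinuousOn g (Set.Icc 0 1)) {ε : ℝ}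
    (hε : 0 < ε) :
    ∀ᶠ n : ℕ in Filter.atTop, ∀ x ∈ Set.Ico (0 : ℝ) 1, |S2 n g x - g x| ≤ ε := by
  have hgi := integrableOn_Ico_of_continuousOn hg
  have hc : ∀ c : ℝ, IntegrableOn (fun _ : ℝ => c) (Set.Ico 0 1) :=
    fun c => integrableOn_const (by simp)
  filter_upwards [eventually_forall_abs_sub_le hg hε] with n hn x hx
  have h1 := S2_sub hgi (hc (g x)) n x
  rw [S2_const _ n hx] at h1
  rw [← h1]
  exact abs_S2_le_of_forall (hgi.sub (hc (g x))) hx (hn x hx)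

lemma eventually_setIntegral_abs_S2_sub_le {f : ℝ → ℝ} (hf : IntegrableOn f (Set.Ico 0 1))
    {ε : ℝ} (hε : 0 < ε) :
    ∀ᶠ n : ℕ in Filter.atTop, ∫ x in Set.Ico (0 : ℝ) 1, |S2 n f x - f x| ≤ ε := by
  have hε3 : 0 < ε / 3 := by positivity
  obtain ⟨g, -, hgf, hg, hgint⟩ :=
    (hf.integrable_indicator measurableSet_Ico).exists_hasCompactSupport_integral_sub_le hε3
  have hgi := integrableOn_Ico_of_continuousOn hg.continuousOn
  have hfg : ∫ x in Set.Ico (0 : ℝ) 1, |f x - g x| ≤ ε / 3 := by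
    refine le_trans ?_ hgf
    have hi : Integrable (fun x => ‖(Set.Ico (0 : ℝ) 1).indicator f x - g x‖) := by
      exact ((hf.integrable_indicator measurableSet_Ico).sub hgint).norm
    refine le_trans (le_of_eq ?_) (setIntegral_le_integral (s := Set.Ico 0 1) hi
      (Filter.Eventually.of_forall fun x => norm_nonneg _))
    refine setIntegral_congr_fun measurableSet_Ico fun x hx => ?_
    simp only [Set.indicator_of_mem hx, Real.norm_eq_abs]
  filter_upwards [eventually_abs_S2_sub_le hg.continuousOn hε3] with n hn
  have hfgi : IntegrableOn (fun x => f x - g x) (Set.Ico 0 1) := hf.sub hgi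
  have hc : IntegrableOn (fun _ : ℝ => ε / 3) (Set.Ico 0 1) := integrableOn_const (by simp)
  have hS : IntegrableOn (fun x => |S2 n (fun t => f t - g t) x|) (Set.Ico 0 1) :=
    (integrableOn_S2 n _).abs
  calc ∫ x in Set.Ico (0 : ℝ) 1, |S2 n f x - f x|
      ≤ ∫ x in Set.Ico (0 : ℝ) 1, (|S2 n (fun t => f t - g t) x| + ε / 3 + |f x - g x|) := by
        refine setIntegral_mono_on ((integrableOn_S2 n f).sub hf).abs
          ((hS.add hc).add hfgi.abs) measurableSet_Ico fun x hx => ?_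
        have h1 := hn x hx
        rw [S2_sub hf hgi]
        have h2 : S2 n f x - f x
            = (S2 n f x - S2 n g x) + (S2 n g x - g x) + -(f x - g x) := by ring
        rw [h2]
        refine (abs_add_three _ _ _).trans ?_
        rw [abs_neg]
        linarith
    _ = (∫ x in Set.Ico (0 : ℝ) 1, |S2 n (fun t => f t - g t) x|) + ε / 3
          + ∫ x in Set.Ico (0 : ℝ) 1, |f x - g x| := by
        rw [integral_add (f := fun x => |S2 n (fun t => f t - g t) x| + ε / 3) (hS.add hc) hfgi.abs,
          integral_add hS hc]
        simp
    _ ≤ ε := by linarith [setIntegral_abs_S2_le hfgi n]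

lemma integrableOn_Icc_of_Ico {f : ℝ → ℝ} (hf : IntegrableOn f (Set.Ico 0 1)) :
    IntegrableOn f (Set.Icc 0 1) :=
  (integrableOn_Icc_iff_integrableOn_Ico (by simp)).2 hf

lemma integrableOn_Ico_mul_continuousOn {f g : ℝ → ℝ} (hf : IntegrableOn f (Set.Ico 0 1))
    (hg : ContinuousOn g (Set.Icc 0 1)) : IntegrableOn (fun x => f x * g x) (Set.Ico 0 1) :=
  ((integrableOn_Icc_of_Ico hf).mul_continuousOn hg isCompact_Icc).mono_set
    Set.Ico_subset_Icc_self

lemma intervalIntegrable_of_integrableOn_Ico {f : ℝ → ℝ} (hf : IntegrableOn f (Set.Ico 0 1))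
    {a b : ℝ} (ha : a ∈ Set.Icc (0 : ℝ) 1) (hb : b ∈ Set.Icc (0 : ℝ) 1) :
    IntervalIntegrable f volume a b := by
  rw [intervalIntegrable_iff]
  exact (integrableOn_Icc_of_Ico hf).mono_set
    (Set.uIoc_subset_uIcc.trans (Set.uIcc_subset_Icc ha hb))

lemma continuousOn_primitive_Icc {f : ℝ → ℝ} (hf : IntegrableOn f (Set.Ico 0 1)) {ξ : ℝ}
    (hξ : ξ ∈ Set.Icc (0 : ℝ) 1) : ContinuousOn (fun x => ∫ t in ξ..x, f t) (Set.Icc 0 1) := by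
  have h := intervalIntegral.continuousOn_primitive_interval' (a := ξ)
    (intervalIntegrable_of_integrableOn_Ico hf (Set.left_mem_Icc.2 zero_le_one)
      (Set.right_mem_Icc.2 zero_le_one)) (by rwa [Set.uIcc_of_le zero_le_one])
  rwa [Set.uIcc_of_le zero_le_one] at h

lemma hasDerivAt_primitive {f : ℝ → ℝ} (hfc : ContinuousOn f (Set.Ico 0 1))
    (hf : IntegrableOn f (Set.Ico 0 1)) {ξ : ℝ} (hξ : ξ ∈ Set.Icc (0 : ℝ) 1) {x : ℝ}
    (hx : x ∈ Set.Ioo (0 : ℝ) 1) : HasDerivAt (fun u => ∫ t in ξ..u, f t) (f x) x :=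
  intervalIntegral.integral_hasDerivAt_right
    (intervalIntegrable_of_integrableOn_Ico hf hξ (Set.Ioo_subset_Icc_self hx))
    ((hfc.mono Set.Ioo_subset_Ico_self).stronglyMeasurableAtFilter isOpen_Ioo x hx)
    (hfc.continuousAt (Ico_mem_nhds hx.1 hx.2))

lemma intervalIntegral_eq_sub_of_hasDerivAt_Ioo {F f : ℝ → ℝ}
    (hF : ContinuousOn F (Set.Icc 0 1)) (hd : ∀ x ∈ Set.Ioo (0 : ℝ) 1, HasDerivAt F (f x) x)
    (hf : IntegrableOn f (Set.Ico 0 1)) {a b : ℝ} (ha : a ∈ Set.Icc (0 : ℝ) 1)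
    (hb : b ∈ Set.Icc (0 : ℝ) 1) : ∫ t in a..b, f t = F b - F a :=
  intervalIntegral.integral_eq_sub_of_hasDeriv_right (hF.mono (Set.uIcc_subset_Icc ha hb))
    (fun x hx => (hd x ⟨(le_min ha.1 hb.1).trans_lt hx.1,
      hx.2.trans_le (max_le ha.2 hb.2)⟩).hasDerivWithinAt)
    (intervalIntegrable_of_integrableOn_Ico hf ha hb)

lemma abs_intervalIntegral_le_setIntegral_abs {f : ℝ → ℝ} (hf : IntegrableOn f (Set.Ico 0 1))
    {a b : ℝ} (ha : a ∈ Set.Icc (0 : ℝ) 1) (hb : b ∈ Set.Icc (0 : ℝ) 1) :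
    |∫ t in a..b, f t| ≤ ∫ t in Set.Ico (0 : ℝ) 1, |f t| := by
  refine (intervalIntegral.norm_integral_le_integral_norm_uIoc (f := f)).trans ?_
  rw [← integral_Icc_eq_integral_Ico]
  exact setIntegral_mono_set (integrableOn_Icc_of_Ico hf).norm
    (Filter.Eventually.of_forall fun x => norm_nonneg _)
    (Set.uIoc_subset_uIcc.trans (Set.uIcc_subset_Icc ha hb)).eventuallyLE

/-- The variation-of-constants formula solves the integrated Cauchy problem. -/
lemma variation_of_constants {p q : ℝ → ℝ} (hpc : ContinuousOn p (Set.Ico 0 1))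
    (hqc : ContinuousOn q (Set.Ico 0 1)) (hpi : IntegrableOn p (Set.Ico 0 1))
    (hqi : IntegrableOn q (Set.Ico 0 1)) {ξ : ℝ} (hξ : ξ ∈ Set.Icc (0 : ℝ) 1) (η : ℝ)
    {Y : ℝ → ℝ} (hY : ∀ x, Y x = Real.exp (-∫ t in ξ..x, p t) *
      (η + ∫ t in ξ..x, q t * Real.exp (∫ s in ξ..t, p s))) :
    ContinuousOn Y (Set.Icc 0 1) ∧
      ∀ x ∈ Set.Icc (0 : ℝ) 1, Y x = η + ∫ t in ξ..x, (q t - p t * Y t) := by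
  have hP := continuousOn_primitive_Icc hpi hξ
  have hqPi : IntegrableOn (fun t => q t * Real.exp (∫ s in ξ..t, p s)) (Set.Ico 0 1) :=
    integrableOn_Ico_mul_continuousOn hqi hP.rexp
  have hqPc : ContinuousOn (fun t => q t * Real.exp (∫ s in ξ..t, p s)) (Set.Ico 0 1) :=
    hqc.mul (hP.rexp.mono Set.Ico_subset_Icc_self)
  have hYc : ContinuousOn Y (Set.Icc 0 1) :=
    (hP.neg.rexp.mul (continuousOn_const.add (continuousOn_primitive_Icc hqPi hξ))).congr
      fun x _ => hY x
  refine ⟨hYc, fun x hx => ?_⟩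
  rw [intervalIntegral_eq_sub_of_hasDerivAt_Ioo (f := fun t => q t - p t * Y t) hYc ?_
    (hqi.sub (integrableOn_Ico_mul_continuousOn hpi hYc)) hξ hx]
  · simp [hY ξ]
  · intro x hx
    have h := ((hasDerivAt_primitive hpc hpi hξ hx).neg.exp).mul
      ((hasDerivAt_primitive hqPc hqPi hξ hx).const_add η)
    have hfun : Y = _ := funext hY
    rw [hfun]
    refine h.congr_deriv ?_
    simp only [Pi.neg_apply, Real.exp_neg]
    field_simp
    ring

lemma abs_intervalIntegral_mul_exp_le {r : ℝ → ℝ} (hrc : ContinuousOn r (Set.Ico 0 1))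
    (hri : IntegrableOn r (Set.Ico 0 1)) (hr : ∀ x, 0 ≤ r x) {ξ s K : ℝ}
    (hK : 0 < K) (hξ : ξ ∈ Set.Icc (0 : ℝ) 1) (hs : s ∈ Set.Icc (0 : ℝ) 1) :
    |∫ t in ξ..s, r t * Real.exp (K * |∫ u in ξ..t, r u|)| ≤
      Real.exp (K * |∫ u in ξ..s, r u|) / K := by
  have hB := continuousOn_primitive_Icc hri hξ
  have key : ∀ c : ℝ, c ≠ 0 → ∫ t in ξ..s, r t * Real.exp (c * ∫ u in ξ..t, r u) =
      (Real.exp (c * ∫ u in ξ..s, r u) - 1) / c := by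
    intro c hc
    rw [intervalIntegral_eq_sub_of_hasDerivAt_Ioo
      (F := fun t => Real.exp (c * ∫ u in ξ..t, r u) / c)
      ((continuousOn_const.mul hB).rexp.div_const c) ?_ ?_ hξ hs]
    · simp
      ring
    · intro x hx
      refine ((((hasDerivAt_primitive hrc hri hξ hx).const_mul c).exp).div_const c).congr_deriv ?_
      field_simp
    · exact integrableOn_Ico_mul_continuousOn hri (continuousOn_const.mul hB).rexp
  rcases le_total ξ s with h | h
  · have hnn : ∀ t, ξ ≤ t → 0 ≤ ∫ u in ξ..t, r u := fun t ht =>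
      intervalIntegral.integral_nonneg ht fun u _ => hr u
    have hcongr : ∫ t in ξ..s, r t * Real.exp (K * |∫ u in ξ..t, r u|) =
        ∫ t in ξ..s, r t * Real.exp (K * ∫ u in ξ..t, r u) := by
      refine intervalIntegral.integral_congr fun t ht => ?_
      rw [Set.uIcc_of_le h] at ht
      simp only [abs_of_nonneg (hnn t ht.1)]
    rw [hcongr, key K hK.ne', abs_of_nonneg (hnn s h), abs_of_nonneg]
    · gcongr
      linarith
    · exact div_nonneg (sub_nonneg.2 (Real.one_le_exp (mul_nonneg hK.le (hnn s h)))) hK.le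
  · have hnp : ∀ t, t ≤ ξ → ∫ u in ξ..t, r u ≤ 0 := fun t ht => by
      rw [intervalIntegral.integral_symm, neg_nonpos]
      exact intervalIntegral.integral_nonneg ht fun u _ => hr u
    have hcongr : ∫ t in ξ..s, r t * Real.exp (K * |∫ u in ξ..t, r u|) =
        ∫ t in ξ..s, r t * Real.exp (-K * ∫ u in ξ..t, r u) := by
      refine intervalIntegral.integral_congr fun t ht => ?_
      rw [Set.uIcc_of_ge h] at ht
      simp only [abs_of_nonpos (hnp t ht.2), mul_neg, neg_mul]
    rw [hcongr, key (-K) (neg_ne_zero.2 hK.ne'), abs_of_nonpos (hnp s h), mul_neg, neg_mul,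
      div_neg, abs_neg, abs_of_nonneg]
    · gcongr
      linarith
    · exact div_nonneg (sub_nonneg.2 (Real.one_le_exp
        (by rw [neg_nonneg]; exact mul_nonpos_of_nonneg_of_nonpos hK.le (hnp s h)))) hK.le

/-- A bounded function whose upper bounds `M` improve to `ρ + 3 / 4 * M` is at most `4 * ρ`. -/
lemma le_four_mul_of_forall_bound_improves {S : Set ℝ} {f : ℝ → ℝ} {ρ : ℝ}
    (hf : ∀ x ∈ S, 0 ≤ f x) (hbdd : ∃ C, ∀ x ∈ S, f x ≤ C)
    (h : ∀ M, 0 ≤ M → (∀ x ∈ S, f x ≤ M) → ∀ x ∈ S, f x ≤ ρ + 3 / 4 * M) :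
    ∀ x ∈ S, f x ≤ 4 * ρ := by
  intro x hx
  have hb : BddAbove (f '' S) := by
    obtain ⟨C, hC⟩ := hbdd
    exact ⟨C, by rintro _ ⟨z, hz, rfl⟩; exact hC z hz⟩
  have hle : ∀ z ∈ S, f z ≤ sSup (f '' S) := fun z hz => le_csSup hb ⟨z, hz, rfl⟩
  have h2 : sSup (f '' S) ≤ ρ + 3 / 4 * sSup (f '' S) := by
    refine csSup_le ⟨_, x, hx, rfl⟩ ?_
    rintro _ ⟨z, hz, rfl⟩
    exact h _ ((hf x hx).trans (hle x hx)) hle z hz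
  linarith [hle x hx]

lemma integrableOn_S2_sub_S2_mul (p q : ℝ → ℝ) {Y yb e : ℝ → ℝ} {n : ℕ}
    (hyb : ∀ x, yb x = S2 n Y x + e x) (hem : Measurable e) (hem' : ∃ C, ∀ x, |e x| ≤ C) :
    IntegrableOn (fun t => S2 n q t - S2 n p t * yb t) (Set.Ico 0 1) := by
  obtain ⟨E, hE⟩ := hem'
  obtain ⟨D, hD⟩ := exists_abs_S2_le n Y
  have hybm : Measurable yb := by
    rw [funext hyb]
    exact (measurable_S2 n Y).add hem
  refine (integrableOn_S2 n q).sub ((integrableOn_S2 n p).mul_bdd (c := D + E)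
    hybm.aestronglyMeasurable (Filter.Eventually.of_forall fun x => ?_))
  rw [hyb]
  exact (abs_add_le _ _).trans (add_le_add (hD x) (hE x))

/-- Comparison of the exact and the discretized integral operators. Here `e` is the deviation of
the discretized solution `yb` from the averages of the exact solution `Y`. -/
lemma abs_primitive_sub_le {p q Y yb e : ℝ → ℝ} {n : ℕ}
    (hpi : IntegrableOn p (Set.Ico 0 1)) (hqi : IntegrableOn q (Set.Ico 0 1))
    (hYc : ContinuousOn Y (Set.Icc 0 1)) (hyb : ∀ x, yb x = S2 n Y x + e x)
    (hem : Measurable e) {m : ℝ} (hem' : ∃ C, ∀ x, |e x| ≤ C)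
    (hm : ∀ x ∈ Set.Ico (0 : ℝ) 1, |e x| ≤ m)
    {C ω δ : ℝ} (hC : ∀ x ∈ Set.Ico (0 : ℝ) 1, |Y x| ≤ C)
    (hω : ∀ x ∈ Set.Ico (0 : ℝ) 1, |S2 n Y x - Y x| ≤ ω)
    (hp : ∫ x in Set.Ico (0 : ℝ) 1, |S2 n p x - p x| ≤ δ)
    (hq : ∫ x in Set.Ico (0 : ℝ) 1, |S2 n q x - q x| ≤ δ)
    {ξ s : ℝ} (hξ : ξ ∈ Set.Icc (0 : ℝ) 1) (hs : s ∈ Set.Icc (0 : ℝ) 1) :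
    |(∫ t in ξ..s, (S2 n q t - S2 n p t * yb t)) - ∫ t in ξ..s, (q t - p t * Y t)| ≤
      δ + ω * (∫ x in Set.Ico (0 : ℝ) 1, |p x|) + (C + m) * δ + |∫ t in ξ..s, (|p t| * |e t|)| := by
  have h0 : (0 : ℝ) ∈ Set.Ico (0 : ℝ) 1 := by simp
  have hC0 : 0 ≤ C := (abs_nonneg _).trans (hC 0 h0)
  have hm0 : 0 ≤ m := (abs_nonneg _).trans (hm 0 h0)
  have hω0 : 0 ≤ ω := (abs_nonneg _).trans (hω 0 h0)
  obtain ⟨E, hE⟩ := hem'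
  have hpei : IntegrableOn (fun t => p t * e t) (Set.Ico 0 1) :=
    hpi.mul_bdd (c := E) hem.aestronglyMeasurable (Filter.Eventually.of_forall hE)
  have hpYi := integrableOn_Ico_mul_continuousOn hpi hYc
  have hSi := integrableOn_S2_sub_S2_mul p q hyb hem ⟨E, hE⟩
  have hGi : IntegrableOn (fun t => q t - p t * Y t) (Set.Ico 0 1) := hqi.sub hpYi
  set h : ℝ → ℝ := fun t => (S2 n q t - S2 n p t * yb t) - (q t - p t * Y t) + p t * e t with hh
  have hdi : IntegrableOn (fun t => (S2 n q t - S2 n p t * yb t) - (q t - p t * Y t))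
    (Set.Ico 0 1) := hSi.sub hGi
  have hhi : IntegrableOn h (Set.Ico 0 1) := hdi.add hpei
  have hsplit : (∫ t in ξ..s, (S2 n q t - S2 n p t * yb t)) - ∫ t in ξ..s, (q t - p t * Y t) =
      (∫ t in ξ..s, h t) - ∫ t in ξ..s, p t * e t := by
    rw [← intervalIntegral.integral_sub (intervalIntegrable_of_integrableOn_Ico hSi hξ hs)
      (intervalIntegrable_of_integrableOn_Ico hGi hξ hs),
      ← intervalIntegral.integral_sub (intervalIntegrable_of_integrableOn_Ico hhi hξ hs)
      (intervalIntegrable_of_integrableOn_Ico hpei hξ hs)]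
    simp only [hh, add_sub_cancel_right]
  have hpe : |∫ t in ξ..s, p t * e t| ≤ |∫ t in ξ..s, (|p t| * |e t|)| := by
    simpa only [Real.norm_eq_abs, abs_mul] using
      intervalIntegral.norm_integral_le_abs_integral_norm (f := fun t => p t * e t) (a := ξ)
        (b := s) (μ := volume)
  have hqd : IntegrableOn (fun t => |S2 n q t - q t|) (Set.Ico 0 1) :=
    ((integrableOn_S2 n q).sub hqi).abs
  have hpd : IntegrableOn (fun t => |S2 n p t - p t|) (Set.Ico 0 1) :=
    ((integrableOn_S2 n p).sub hpi).abs
  have hpa : IntegrableOn (fun t => |S2 n p t|) (Set.Ico 0 1) := (integrableOn_S2 n p).abs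
  have hhint : ∫ t in Set.Ico (0 : ℝ) 1, |h t| ≤
      δ + ω * (∫ x in Set.Ico (0 : ℝ) 1, |p x|) + (C + m) * δ := by
    calc ∫ t in Set.Ico (0 : ℝ) 1, |h t|
        ≤ ∫ t in Set.Ico (0 : ℝ) 1, (|S2 n q t - q t| + ω * |S2 n p t|
            + (C + m) * |S2 n p t - p t|) := by
          refine setIntegral_mono_on hhi.abs ((hqd.add (hpa.const_mul ω)).add
            (hpd.const_mul (C + m))) measurableSet_Ico fun t ht => ?_
          have h2 : h t = (S2 n q t - q t) + -(S2 n p t * (S2 n Y t - Y t))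
              + -((S2 n p t - p t) * (Y t + e t)) := by
            simp only [hh, hyb]
            ring
          rw [h2]
          refine (abs_add_three _ _ _).trans ?_
          rw [abs_neg, abs_neg, abs_mul, abs_mul, mul_comm |S2 n p t|, mul_comm |S2 n p t - p t|]
          gcongr
          · exact hω t ht
          · exact (abs_add_le _ _).trans (add_le_add (hC t ht) (hm t ht))
      _ = (∫ t in Set.Ico (0 : ℝ) 1, |S2 n q t - q t|)
            + ω * (∫ t in Set.Ico (0 : ℝ) 1, |S2 n p t|)
            + (C + m) * ∫ t in Set.Ico (0 : ℝ) 1, |S2 n p t - p t| := by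
          rw [integral_add (f := fun t => |S2 n q t - q t| + ω * |S2 n p t|)
            (hqd.add (hpa.const_mul ω)) (hpd.const_mul (C + m)),
            integral_add hqd (hpa.const_mul ω), integral_const_mul, integral_const_mul]
      _ ≤ _ := by
          exact add_le_add_three hq
            (mul_le_mul_of_nonneg_left (setIntegral_abs_S2_le hpi n) hω0)
            (mul_le_mul_of_nonneg_left hp (add_nonneg hC0 hm0))
  rw [hsplit]
  refine (abs_sub _ _).trans (add_le_add ?_ hpe)
  exact (abs_intervalIntegral_le_setIntegral_abs hhi hξ hs).trans hhint

/-- A discrete Grönwall estimate for the deviation `e` of the discretized solution from the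
averages of the exact solution. -/
lemma abs_deviation_le {p q Y yb e : ℝ → ℝ} {n : ℕ} {ξ η : ℝ}
    (hpc : ContinuousOn p (Set.Ico 0 1))
    (hpi : IntegrableOn p (Set.Ico 0 1)) (hqi : IntegrableOn q (Set.Ico 0 1))
    (hξ : ξ ∈ Set.Icc (0 : ℝ) 1)
    (hYc : ContinuousOn Y (Set.Icc 0 1)) (hyb : ∀ x, yb x = S2 n Y x + e x)
    (hem : Measurable e) (hem' : ∃ C, ∀ x, |e x| ≤ C)
    (hY : ∀ x ∈ Set.Ico (0 : ℝ) 1, Y x = η + ∫ t in ξ..x, (q t - p t * Y t))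
    (hybar : ∀ x ∈ Set.Ico (0 : ℝ) 1, yb x =
        η + S2 n (fun s => ∫ t in ξ..s, (S2 n q t - S2 n p t * yb t)) x)
    {C L ω δ : ℝ} (hC : ∀ x ∈ Set.Ico (0 : ℝ) 1, |Y x| ≤ C)
    (hL : ∫ x in Set.Ico (0 : ℝ) 1, |p x| = L)
    (hω : ∀ x ∈ Set.Ico (0 : ℝ) 1, |S2 n Y x - Y x| ≤ ω)
    (hp : ∫ x in Set.Ico (0 : ℝ) 1, |S2 n p x - p x| ≤ δ)
    (hq : ∫ x in Set.Ico (0 : ℝ) 1, |S2 n q x - q x| ≤ δ)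
    (hδ : δ * Real.exp (4 * L) ≤ 1 / 4)
    (hosc : ∀ x ∈ Set.Ico (0 : ℝ) 1, ∀ t ∈ Set.Ico (0 : ℝ) 1, |t - x| ≤ (1 / 2) ^ n →
      |(∫ u in ξ..t, |p u|) - (∫ u in ξ..x, |p u|)| ≤ Real.log 2 / 4) :
    ∀ x ∈ Set.Ico (0 : ℝ) 1, |e x| ≤ 4 * (δ + ω * L + C * δ) * Real.exp (4 * L) := by
  have h0 : (0 : ℝ) ∈ Set.Ico (0 : ℝ) 1 := by simp
  have hC0 : 0 ≤ C := (abs_nonneg _).trans (hC 0 h0)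
  have hω0 : 0 ≤ ω := (abs_nonneg _).trans (hω 0 h0)
  have hL0 : 0 ≤ L := hL ▸ integral_nonneg fun x => abs_nonneg _
  have hδ0 : 0 ≤ δ := (integral_nonneg fun x => abs_nonneg _).trans hp
  set A : ℝ → ℝ := fun x => |∫ u in ξ..x, (|p u|)| with hA
  have hpai : IntegrableOn (fun x => |p x|) (Set.Ico 0 1) := hpi.abs
  have hAL : ∀ x ∈ Set.Ico (0 : ℝ) 1, A x ≤ L := fun x hx => by
    have := abs_intervalIntegral_le_setIntegral_abs hpai hξ (Set.Ico_subset_Icc_self hx)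
    simpa only [abs_abs, hL] using this
  have hA0 : ∀ x, 0 ≤ A x := fun x => abs_nonneg _
  set ρ : ℝ := δ + ω * L + C * δ with hρ
  have hρ0 : 0 ≤ ρ := by positivity
  obtain ⟨E, hE⟩ := hem'
  set F : ℝ → ℝ := fun s => ∫ t in ξ..s, (S2 n q t - S2 n p t * yb t) with hF
  set G : ℝ → ℝ := fun s => ∫ t in ξ..s, (q t - p t * Y t) with hG
  have hFi : IntegrableOn F (Set.Ico 0 1) :=
    integrableOn_Ico_of_continuousOn (continuousOn_primitive_Icc
      (integrableOn_S2_sub_S2_mul p q hyb hem ⟨E, hE⟩) hξ)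
  have hGi : IntegrableOn G (Set.Ico 0 1) :=
    integrableOn_Ico_of_continuousOn (continuousOn_primitive_Icc
      (hqi.sub (integrableOn_Ico_mul_continuousOn hpi hYc)) hξ)
  have he : ∀ x ∈ Set.Ico (0 : ℝ) 1, e x = S2 n (fun s => F s - G s) x := by
    intro x hx
    have h1 : S2 n G x = S2 n Y x - η := by
      have h2 := S2_sub (integrableOn_Ico_of_continuousOn hYc)
        (integrableOn_const (C := η) (by simp)) n x
      rw [S2_const η n hx] at h2
      rw [← h2]
      refine S2_congr (fun t ht => ?_) n x
      simp only [hY t ht, hG, add_sub_cancel_left]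
    rw [S2_sub hFi hGi, h1]
    linarith [hyb x, hybar x hx]
  have key : ∀ x ∈ Set.Ico (0 : ℝ) 1, |e x| * Real.exp (-(4 * A x)) ≤ 4 * ρ := by
    refine le_four_mul_of_forall_bound_improves (fun x _ => by positivity)
      ⟨E, fun x _ => ?_⟩ fun M hM hMe x hx => ?_
    · refine (mul_le_of_le_one_right (abs_nonneg _) ?_).trans (hE x)
      rw [Real.exp_le_one_iff]
      linarith [hA0 x]
    have heM : ∀ t ∈ Set.Ico (0 : ℝ) 1, |e t| ≤ M * Real.exp (4 * A t) := fun t ht => by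
      have := hMe t ht
      rwa [Real.exp_neg, ← div_eq_mul_inv, div_le_iff₀ (Real.exp_pos _)] at this
    have heL : ∀ t ∈ Set.Ico (0 : ℝ) 1, |e t| ≤ M * Real.exp (4 * L) := fun t ht =>
      (heM t ht).trans (by gcongr; exact hAL t ht)
    have hFG : ∀ s ∈ Set.Ico (0 : ℝ) 1,
        |F s - G s| ≤ ρ + M / 4 + M * (Real.exp (4 * A s) / 4) := by
      intro s hs
      have hsI := Set.Ico_subset_Icc_self hs
      have h1 := abs_primitive_sub_le hpi hqi hYc hyb hem ⟨E, hE⟩ heL hC hω hp hq hξ hsI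
      have h2 : |∫ t in ξ..s, (|p t| * |e t|)| ≤ M * (Real.exp (4 * A s) / 4) := by
        have hexpi : IntegrableOn (fun t => |p t| * Real.exp (4 * A t)) (Set.Ico 0 1) :=
          integrableOn_Ico_mul_continuousOn hpai
            (continuousOn_const.mul (continuousOn_primitive_Icc hpai hξ).abs).rexp
        have h3 : |∫ t in ξ..s, (|p t| * |e t|)| ≤
            |∫ t in ξ..s, M * (|p t| * Real.exp (4 * A t))| := by
          rw [← Real.norm_eq_abs]
          refine intervalIntegral.norm_integral_le_abs_of_norm_le ?_
            (intervalIntegrable_of_integrableOn_Ico (hexpi.const_mul M) hξ hsI)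
          have hsub : Set.uIoc ξ s ⊆ Set.Icc 0 1 :=
            Set.uIoc_subset_uIcc.trans (Set.uIcc_subset_Icc hξ hsI)
          filter_upwards [ae_restrict_mem measurableSet_uIoc,
            (volume.restrict (Set.uIoc ξ s)).ae_ne 1] with t ht ht1
          have h4 := heM t ⟨(hsub ht).1, lt_of_le_of_ne (hsub ht).2 ht1⟩
          rw [Real.norm_eq_abs, abs_mul, abs_abs, abs_abs, mul_left_comm]
          gcongr
        refine h3.trans ?_
        rw [intervalIntegral.integral_const_mul, abs_mul, abs_of_nonneg hM]
        exact mul_le_mul_of_nonneg_left (abs_intervalIntegral_mul_exp_le hpc.abs hpai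
          (fun _ => abs_nonneg _) four_pos hξ hsI) hM
      rw [hL] at h1
      have h4 : M * Real.exp (4 * L) * δ ≤ M / 4 := by nlinarith
      calc |F s - G s| ≤ _ := h1
        _ ≤ _ := by rw [hρ]; nlinarith
    have hS : |e x| ≤ ρ + M / 4 + M * (2 * Real.exp (4 * A x) / 4) := by
      rw [he x hx]
      refine abs_S2_le_of_forall (hFi.sub hGi) hx fun t ht htx => (hFG t ht).trans ?_
      have h5 : 4 * A t ≤ Real.log 2 + 4 * A x := by
        have := (abs_abs_sub_abs_le _ _).trans (hosc x hx t ht htx)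
        have := (abs_le.1 this).2
        simp only [hA]
        linarith
      have h6 : Real.exp (4 * A t) ≤ 2 * Real.exp (4 * A x) := by
        have h7 := Real.exp_le_exp.2 h5
        rwa [Real.exp_add, Real.exp_log two_pos] at h7
      gcongr
    rw [Real.exp_neg, ← div_eq_mul_inv, div_le_iff₀ (Real.exp_pos _)]
    have h7 : 1 ≤ Real.exp (4 * A x) := Real.one_le_exp (by linarith [hA0 x])
    nlinarith
  intro x hx
  have h8 := key x hx
  rw [Real.exp_neg, ← div_eq_mul_inv, div_le_iff₀ (Real.exp_pos _)] at h8
  refine h8.trans ?_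
  gcongr
  exact hAL x hx

/-- Uniform convergence on `[0,1)` of the discretized solutions `ȳ_n` to the exact
solution of the Cauchy problem `y' + p y = q`, `y(ξ) = η`. -/
theorem uniform_convergence_discretized_solution (p q : ℝ → ℝ)
    (hpc : ContinuousOn p (Set.Ico 0 1)) (hqc : ContinuousOn q (Set.Ico 0 1))
    (hpi : IntegrableOn p (Set.Ico (0:ℝ) 1)) (hqi : IntegrableOn q (Set.Ico (0:ℝ) 1))
    (ξ : ℝ) (hξ : ξ ∈ Set.Ico (0:ℝ) 1) (η : ℝ)
    (y : ℝ → ℝ)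
    (hy : ∀ x ∈ Set.Ico (0:ℝ) 1, y x =
      Real.exp (-∫ t in ξ..x, p t) *
        (η + ∫ t in ξ..x, q t * Real.exp (∫ s in ξ..t, p s)))
    (ybar : ℕ → ℝ → ℝ) (N : ℕ)
    (hybar : ∀ n, N ≤ n →
      (∃ c : Fin (2 ^ n) → ℝ, ∀ x : ℝ, ybar n x = ∑ k : Fin (2 ^ n), c k * walsh k.1 x) ∧
      ∀ x ∈ Set.Ico (0:ℝ) 1, ybar n x =
        η + S2 n (fun s => ∫ t in ξ..s, (S2 n q t - S2 n p t * ybar n t)) x) :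
    TendstoUniformlyOn ybar y Filter.atTop (Set.Ico 0 1) := by
  have hξ' := Set.Ico_subset_Icc_self hξ
  obtain ⟨Y, hYdef⟩ : ∃ Y : ℝ → ℝ, ∀ x, Y x = Real.exp (-∫ t in ξ..x, p t) *
      (η + ∫ t in ξ..x, q t * Real.exp (∫ s in ξ..t, p s)) := ⟨_, fun _ => rfl⟩
  have hyY : ∀ x ∈ Set.Ico (0 : ℝ) 1, y x = Y x := fun x hx => (hy x hx).trans (hYdef x).symm
  obtain ⟨hYc, hYeq⟩ := variation_of_constants hpc hqc hpi hqi hξ' η hYdef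
  obtain ⟨C, hC⟩ := isCompact_Icc.exists_bound_of_continuousOn hYc
  have hC' : ∀ x ∈ Set.Ico (0 : ℝ) 1, |Y x| ≤ C := fun x hx => hC x (Set.Ico_subset_Icc_self hx)
  have hC0 : 0 ≤ C := (abs_nonneg _).trans (hC' 0 (by simp))
  obtain ⟨L, hL⟩ : ∃ L, ∫ x in Set.Ico (0 : ℝ) 1, |p x| = L := ⟨_, rfl⟩
  have hL0 : 0 ≤ L := hL ▸ integral_nonneg fun x => abs_nonneg _
  rw [Metric.tendstoUniformlyOn_iff]
  intro ε hε
  set c : ℝ := 4 * (1 + L + C) * Real.exp (4 * L) + 1 with hc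
  have hc0 : 0 < c := by positivity
  set δ : ℝ := min (ε / (2 * c)) (1 / (4 * Real.exp (4 * L))) with hδ
  have hδ0 : 0 < δ := lt_min (by positivity) (by positivity)
  have hδ1 : δ * Real.exp (4 * L) ≤ 1 / 4 := by
    have h : δ ≤ 1 / (4 * Real.exp (4 * L)) := min_le_right _ _
    rw [le_div_iff₀ (by positivity)] at h
    linarith
  have hδ2 : δ * c < ε := by
    have h : δ ≤ ε / (2 * c) := min_le_left _ _
    rw [le_div_iff₀ (by positivity)] at h
    linarith
  filter_upwards [Filter.eventually_ge_atTop N, eventually_abs_S2_sub_le hYc hδ0,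
    eventually_setIntegral_abs_S2_sub_le hpi hδ0, eventually_setIntegral_abs_S2_sub_le hqi hδ0,
    eventually_forall_abs_sub_le (continuousOn_primitive_Icc (f := fun x => |p x|) hpi.abs hξ')
      (div_pos (Real.log_pos one_lt_two) four_pos)] with n hn hω hp hq hosc x hx
  obtain ⟨⟨a, ha⟩, heq⟩ := hybar n hn
  have hbm : Measurable (ybar n) := by
    rw [funext ha]
    exact Finset.measurable_fun_sum _ fun k _ => (measurable_walsh k.1).const_mul _
  have hbb : ∀ x, |ybar n x| ≤ ∑ k, |a k| := fun x => by
    rw [ha]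
    refine (Finset.abs_sum_le_sum_abs _ _).trans (le_of_eq ?_)
    simp [abs_mul, abs_walsh]
  obtain ⟨D, hD⟩ := exists_abs_S2_le n Y
  have he := abs_deviation_le (e := fun x => ybar n x - S2 n Y x) hpc hpi hqi hξ' hYc
    (fun x => (add_sub_cancel _ _).symm) (hbm.sub (measurable_S2 n Y))
    ⟨∑ k, |a k| + D, fun x => (abs_sub _ _).trans (add_le_add (hbb x) (hD x))⟩
    (fun x hx => hYeq x (Set.Ico_subset_Icc_self hx)) heq hC' hL hω hp hq hδ1 hosc x hx
  rw [hyY x hx, dist_comm, Real.dist_eq]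
  calc |ybar n x - Y x| ≤ |ybar n x - S2 n Y x| + |S2 n Y x - Y x| := abs_sub_le _ _ _
    _ ≤ 4 * (δ + δ * L + C * δ) * Real.exp (4 * L) + δ := add_le_add he (hω x hx)
    _ = δ * c := by rw [hc]; ring
    _ < ε := hδ2
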